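/- Let 𝕜 be ℝ or ℂ. Then g[CP_{2n}(𝕜)] ≥ 2·g[CP_n(𝕜)] for every n ≥ 1. -/

import Mathlib

open scoped BigOperators

/-- `geIter A k` is the Gaussian elimination iterate `A^{(k+1)}` (0-indexed, `geIter A 0 = A`).
Entries with row or column index `< k` are left unchanged; they are irrelevant. -/
noncomputable def geIter {𝕜 : Type*} [Field 𝕜] {n : ℕ} (A : Matrix (Fin n) (Fin n) 𝕜) :
    ℕ → Matrix (Fin n) (Fin n) 𝕜
  | 0 => A
  | k + 1 => fun i j =>
    if h : k < n ∧ k + 1 ≤ i.1 ∧ k + 1 ≤ j.1 then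
      geIter A k i j -
        geIter A k i ⟨k, h.1⟩ * geIter A k ⟨k, h.1⟩ j / geIter A k ⟨k, h.1⟩ ⟨k, h.1⟩
    else geIter A k i j

/-- The norm of the pivot `a^{(k+1)}_{k,k}` (0-indexed). -/
noncomputable def pivotNorm {𝕜 : Type*} [RCLike 𝕜] {n : ℕ}
    (A : Matrix (Fin n) (Fin n) 𝕜) (k : ℕ) : ℝ :=
  if h : k < n then ‖geIter A k ⟨k, h⟩ ⟨k, h⟩‖ else 0

/-- The growth factor `g(A)`. -/
noncomputable def growth {𝕜 : Type*} [RCLike 𝕜] {n : ℕ} (A : Matrix (Fin n) (Fin n) 𝕜) : ℝ :=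
  (⨆ k : Fin n, ⨆ i : Fin n, ⨆ j : Fin n,
      if k.1 ≤ i.1 ∧ k.1 ≤ j.1 then ‖geIter A k.1 i j‖ else 0) /
    ⨆ i : Fin n, ⨆ j : Fin n, ‖A i j‖

/-- `A` is completely pivoted: `A ∈ CP_n(𝕜)`. -/
def IsCP {𝕜 : Type*} [RCLike 𝕜] {n : ℕ} (A : Matrix (Fin n) (Fin n) 𝕜) : Prop :=
  A.det ≠ 0 ∧ (∀ k : ℕ, k + 1 < n → pivotNorm A k ≠ 0) ∧
    ∀ (k : ℕ) (i j : Fin n), k ≤ i.1 → k ≤ j.1 → ‖geIter A k i j‖ ≤ pivotNorm A k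

/-- `g[CP_n(𝕜)]`. -/
noncomputable def gCP (𝕜 : Type*) [RCLike 𝕜] (n : ℕ) : ℝ :=
  sSup (growth '' {A : Matrix (Fin n) (Fin n) 𝕜 | IsCP A})

/-- Index halving. -/
def hfIdx {n : ℕ} (i : Fin (2 * n)) : Fin n := ⟨i.1 / 2, by have := i.2; omega⟩

/-- Sign pattern of `[[1,1],[1,-1]]`. -/
def sgn2 (𝕜 : Type*) [Field 𝕜] (a b : ℕ) : 𝕜 := if a % 2 = 1 ∧ b % 2 = 1 then -1 else 1

/-- `A ⊗ [[1,1],[1,-1]]`. -/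
def dbl {𝕜 : Type*} [Field 𝕜] {n : ℕ} (A : Matrix (Fin n) (Fin n) 𝕜) :
    Matrix (Fin (2 * n)) (Fin (2 * n)) 𝕜 :=
  fun i j => A (hfIdx i) (hfIdx j) * sgn2 𝕜 i.1 j.1

theorem geIter_succ_of {𝕜 : Type*} [Field 𝕜] {n : ℕ} (A : Matrix (Fin n) (Fin n) 𝕜) (k : ℕ)
    (hk : k < n) (i j : Fin n) (hi : k + 1 ≤ i.1) (hj : k + 1 ≤ j.1) :
    geIter A (k + 1) i j = geIter A k i j -
        geIter A k i ⟨k, hk⟩ * geIter A k ⟨k, hk⟩ j / geIter A k ⟨k, hk⟩ ⟨k, hk⟩ := by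
  exact dif_pos (c := k < n ∧ k + 1 ≤ i.1 ∧ k + 1 ≤ j.1) ⟨hk, hi, hj⟩

theorem dbl_odd {𝕜 : Type*} [Field 𝕜] {n : ℕ} (A : Matrix (Fin n) (Fin n) 𝕜) (k : ℕ) (hk : k < n)
    (he : ∀ i j : Fin (2 * n), 2 * k ≤ i.1 → 2 * k ≤ j.1 →
      geIter (dbl A) (2 * k) i j = geIter A k (hfIdx i) (hfIdx j) * sgn2 𝕜 i.1 j.1)
    (i j : Fin (2 * n)) (hi : 2 * k + 1 ≤ i.1) (hj : 2 * k + 1 ≤ j.1) :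
    geIter (dbl A) (2 * k + 1) i j = geIter A k (hfIdx i) (hfIdx j) * sgn2 𝕜 i.1 j.1 -
      geIter A k (hfIdx i) ⟨k, hk⟩ * geIter A k ⟨k, hk⟩ (hfIdx j) /
        geIter A k ⟨k, hk⟩ ⟨k, hk⟩ := by
  have h2 : 2 * k < 2 * n := by omega
  have hh : hfIdx (⟨2 * k, h2⟩ : Fin (2 * n)) = ⟨k, hk⟩ := by
    apply Fin.ext; simp [hfIdx]
  rw [geIter_succ_of _ _ h2 i j hi hj, he _ _ (by omega) (by omega), he i ⟨2 * k, h2⟩ (by omega)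
    le_rfl, he ⟨2 * k, h2⟩ j le_rfl (by omega), he ⟨2 * k, h2⟩ ⟨2 * k, h2⟩ le_rfl le_rfl, hh]
  simp [sgn2]

theorem dbl_even {𝕜 : Type*} [Field 𝕜] [CharZero 𝕜] {n : ℕ} (A : Matrix (Fin n) (Fin n) 𝕜)
    (hp : ∀ k (hk : k < n), geIter A k ⟨k, hk⟩ ⟨k, hk⟩ ≠ 0) (k : ℕ) (hk : k < n) :
    ∀ i j : Fin (2 * n), 2 * k ≤ i.1 → 2 * k ≤ j.1 →
      geIter (dbl A) (2 * k) i j = geIter A k (hfIdx i) (hfIdx j) * sgn2 𝕜 i.1 j.1 := by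
  induction k with
  | zero => intro i j _ _; rfl
  | succ k ih =>
    intro i j hi hj
    have hk' : k < n := by omega
    have ho := dbl_odd A k hk' (ih hk')
    have h2 : 2 * k + 1 < 2 * n := by omega
    have hh : hfIdx (⟨2 * k + 1, h2⟩ : Fin (2 * n)) = ⟨k, hk'⟩ := by
      apply Fin.ext; simp only [hfIdx]; omega
    have hm : (2 * k + 1) % 2 = 1 := by omega
    have hpk := hp k hk'
    rw [show 2 * (k + 1) = (2 * k + 1) + 1 by ring,
      geIter_succ_of _ _ h2 i j (by omega) (by omega),
      ho i j (by omega) (by omega), ho i ⟨2 * k + 1, h2⟩ (by omega) le_rfl,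
      ho ⟨2 * k + 1, h2⟩ j le_rfl (by omega), ho ⟨2 * k + 1, h2⟩ ⟨2 * k + 1, h2⟩ le_rfl le_rfl, hh,
      geIter_succ_of A k hk' _ _ (by simp only [hfIdx]; omega) (by simp only [hfIdx]; omega)]
    generalize geIter A k ⟨k, hk'⟩ ⟨k, hk'⟩ = p at *
    generalize geIter A k (hfIdx i) ⟨k, hk'⟩ = x
    generalize geIter A k ⟨k, hk'⟩ (hfIdx j) = y
    generalize geIter A k (hfIdx i) (hfIdx j) = a
    have hpp : p * p / p = p := by field_simp
    have hden : p * (-1) - p ≠ 0 := by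
      intro h
      apply hpk
      have : (2 : 𝕜) * p = 0 := by linear_combination -h
      simpa using this
    have e1 : x * p / p = x := by field_simp
    have e2 : p * y / p = y := by field_simp
    simp only [sgn2, hm, hpp, e1, e2, and_true, true_and, if_true]
    by_cases h1 : i.1 % 2 = 1 <;> by_cases h3 : j.1 % 2 = 1 <;> simp only [h1, h3, and_true,
      and_false, false_and, if_true, if_false, and_self, mul_one, sub_self, zero_mul, mul_zero,
      zero_div, sub_zero]
    have hden' : p * (-1) - p = -2 * p := by ring
    rw [hden']
    field_simp
    ring

theorem row_comb {𝕜 : Type*} [Field 𝕜] {n : ℕ} (A : Matrix (Fin n) (Fin n) 𝕜)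
    (hp : ∀ k (hk : k + 1 < n), geIter A k ⟨k, by omega⟩ ⟨k, by omega⟩ ≠ 0) (k : ℕ) (hk : k < n) :
    ∀ i : Fin n, k ≤ i.1 → ∃ c : Fin n → 𝕜, c i = 1 ∧ (∀ l : Fin n, k ≤ l.1 → l ≠ i → c l = 0) ∧
      ∀ j, Matrix.vecMul c A j = if j.1 < k then 0 else geIter A k i j := by
  induction k with
  | zero =>
    intro i _
    refine ⟨Pi.single i 1, by simp, ?_, ?_⟩
    · intro l _ hl; simp [hl]
    · intro j; simp [geIter]
  | succ k ih =>
    intro i hi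
    have hk' : k < n := by omega
    obtain ⟨c, c1, c2, c3⟩ := ih hk' i (by omega)
    obtain ⟨d, d1, d2, d3⟩ := ih hk' ⟨k, hk'⟩ le_rfl
    have hpk := hp k hk
    have hik : i ≠ ⟨k, hk'⟩ := by intro h; rw [h] at hi; simp at hi
    refine ⟨c - (geIter A k i ⟨k, hk'⟩ / geIter A k ⟨k, hk'⟩ ⟨k, hk'⟩) • d, ?_, ?_, ?_⟩
    · simp [c1, d2 i (by omega) hik]
    · intro l hl hli
      have : l ≠ ⟨k, hk'⟩ := by intro h; rw [h] at hl; simp at hl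
      simp [c2 l (by omega) hli, d2 l (by omega) this]
    · intro j
      rw [Matrix.sub_vecMul, Matrix.smul_vecMul, Pi.sub_apply, Pi.smul_apply, c3, d3, smul_eq_mul]
      rcases lt_trichotomy j.1 k with h | h | h
      · simp [h, show j.1 < k + 1 by omega]
      · have : j = ⟨k, hk'⟩ := Fin.ext h
        subst this
        simp only [lt_irrefl, if_false, Nat.lt_succ_self, if_true]
        field_simp
        simp
      · rw [if_neg (by omega), if_neg (by omega), if_neg (by omega),
          geIter_succ_of A k hk' i j hi (by omega)]
        ring

theorem pivots_ne {𝕜 : Type*} [RCLike 𝕜] {n : ℕ} {A : Matrix (Fin n) (Fin n) 𝕜} (hA : IsCP A)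
    (k : ℕ) (hk : k < n) : geIter A k ⟨k, hk⟩ ⟨k, hk⟩ ≠ 0 := by
  have hp : ∀ k (hk : k + 1 < n), geIter A k ⟨k, by omega⟩ ⟨k, by omega⟩ ≠ 0 := by
    intro k hk h
    have := hA.2.1 k hk
    rw [pivotNorm, dif_pos (by omega), h] at this
    simp at this
  by_cases h : k + 1 < n
  · exact hp k h
  · intro h0
    obtain ⟨c, c1, -, c3⟩ := row_comb A hp k hk ⟨k, hk⟩ le_rfl
    apply hA.1
    rw [← Matrix.exists_vecMul_eq_zero_iff]
    refine ⟨c, fun hc => by simp [hc] at c1, ?_⟩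
    funext j
    rw [c3]
    split_ifs with hj
    · rfl
    · have : j = ⟨k, hk⟩ := Fin.ext (by have := j.2; simp only; omega)
      rw [this, h0]; rfl

theorem det_dbl {𝕜 : Type*} [Field 𝕜] [CharZero 𝕜] {n : ℕ} (A : Matrix (Fin n) (Fin n) 𝕜)
    (h : A.det ≠ 0) : (dbl A).det ≠ 0 := by
  let e : Fin n × Fin 2 ≃ Fin (2 * n) := finProdFinEquiv.trans (finCongr (mul_comm n 2))
  have : dbl A = Matrix.reindex e e
      (Matrix.kroneckerMap (· * ·) A (!![1, 1; 1, -1] : Matrix (Fin 2) (Fin 2) 𝕜)) := by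
    ext i j
    obtain ⟨⟨i, a⟩, rfl⟩ := e.surjective i
    obtain ⟨⟨j, b⟩, rfl⟩ := e.surjective j
    have h1 : ∀ (i : Fin n) (a : Fin 2), (e (i, a)).1 = a.1 + 2 * i.1 := fun i a => rfl
    have h2 : ∀ (i : Fin n) (a : Fin 2), hfIdx (e (i, a)) = i := by
      intro i a
      apply Fin.ext
      simp only [hfIdx, h1]
      omega
    simp only [dbl, h2, Matrix.reindex_apply, Matrix.submatrix_apply, Equiv.symm_apply_apply,
      Matrix.kroneckerMap_apply, h1, sgn2]
    fin_cases a <;> fin_cases b <;> simp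
  rw [this, Matrix.det_reindex_self, Matrix.det_kronecker]
  apply mul_ne_zero
  · exact pow_ne_zero _ h
  · apply pow_ne_zero
    rw [Matrix.det_fin_two_of]
    norm_num

theorem next_le {𝕜 : Type*} [RCLike 𝕜] (a x y p : 𝕜) (h1 : ‖a‖ ≤ ‖p‖) (h2 : ‖x‖ ≤ ‖p‖)
    (h3 : ‖y‖ ≤ ‖p‖) : ‖a - x * y / p‖ ≤ 2 * ‖p‖ := by
  have : ‖x * y / p‖ ≤ ‖p‖ := by
    rw [norm_div, norm_mul]
    apply div_le_of_le_mul₀ (norm_nonneg _) (norm_nonneg _)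
    gcongr
  linarith [norm_sub_le a (x * y / p)]

theorem cp_le {𝕜 : Type*} [RCLike 𝕜] {n : ℕ} {A : Matrix (Fin n) (Fin n) 𝕜} (hA : IsCP A) (k : ℕ)
    (hk : k < n) (i j : Fin n) (hi : k ≤ i.1) (hj : k ≤ j.1) :
    ‖geIter A k i j‖ ≤ ‖geIter A k ⟨k, hk⟩ ⟨k, hk⟩‖ := by
  have := hA.2.2 k i j hi hj
  rwa [pivotNorm, dif_pos hk] at this

theorem norm_sgn2 {𝕜 : Type*} [RCLike 𝕜] (a b : ℕ) : ‖sgn2 𝕜 a b‖ = 1 := by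
  unfold sgn2; split_ifs <;> simp

theorem dbl_pivot_odd {𝕜 : Type*} [RCLike 𝕜] {n : ℕ} {A : Matrix (Fin n) (Fin n) 𝕜} (hA : IsCP A)
    (k : ℕ) (hk : k < n) (h2 : 2 * k + 1 < 2 * n) :
    geIter (dbl A) (2 * k + 1) ⟨2 * k + 1, h2⟩ ⟨2 * k + 1, h2⟩
      = -2 * geIter A k ⟨k, hk⟩ ⟨k, hk⟩ := by
  have hpk := pivots_ne hA k hk
  have hh : hfIdx (⟨2 * k + 1, h2⟩ : Fin (2 * n)) = ⟨k, hk⟩ := by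
    apply Fin.ext; simp only [hfIdx]; omega
  have hm : (2 * k + 1) % 2 = 1 := by omega
  rw [dbl_odd A k hk (dbl_even A (pivots_ne hA) k hk) _ _ le_rfl le_rfl, hh]
  simp only [sgn2, hm, and_self, if_true]
  field_simp
  ring

theorem dbl_pivot_even {𝕜 : Type*} [RCLike 𝕜] {n : ℕ} {A : Matrix (Fin n) (Fin n) 𝕜} (hA : IsCP A)
    (k : ℕ) (hk : k < n) (h2 : 2 * k < 2 * n) :
    geIter (dbl A) (2 * k) ⟨2 * k, h2⟩ ⟨2 * k, h2⟩ = geIter A k ⟨k, hk⟩ ⟨k, hk⟩ := by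
  have hh : hfIdx (⟨2 * k, h2⟩ : Fin (2 * n)) = ⟨k, hk⟩ := by
    apply Fin.ext; simp [hfIdx]
  rw [dbl_even A (pivots_ne hA) k hk _ _ le_rfl le_rfl, hh]
  simp [sgn2]

theorem isCP_dbl {𝕜 : Type*} [RCLike 𝕜] {n : ℕ} {A : Matrix (Fin n) (Fin n) 𝕜} (hA : IsCP A) :
    IsCP (dbl A) := by
  refine ⟨det_dbl A hA.1, ?_, ?_⟩
  · intro m hm
    rw [pivotNorm, dif_pos (by omega), norm_ne_zero_iff]
    obtain ⟨k, rfl | rfl⟩ := m.even_or_odd'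
    · rw [dbl_pivot_even hA k (by omega)]
      exact pivots_ne hA _ _
    · rw [dbl_pivot_odd hA k (by omega)]
      exact mul_ne_zero (by norm_num) (pivots_ne hA _ _)
  · intro m i j hi hj
    have hin := i.2
    rw [pivotNorm, dif_pos (by omega)]
    obtain ⟨k, rfl | rfl⟩ := m.even_or_odd'
    · have hk : k < n := by omega
      rw [dbl_pivot_even hA k hk, dbl_even A (pivots_ne hA) k hk _ _ hi hj, norm_mul, norm_sgn2,
        mul_one]
      exact cp_le hA k hk _ _ (by simp only [hfIdx]; omega) (by simp only [hfIdx]; omega)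
    · have hk : k < n := by omega
      rw [dbl_pivot_odd hA k hk, dbl_odd A k hk (dbl_even A (pivots_ne hA) k hk) _ _ hi hj,
        norm_mul, norm_neg, RCLike.norm_ofNat]
      apply next_le _ _ _ _
      · rw [norm_mul, norm_sgn2, mul_one]
        exact cp_le hA k hk _ _ (by simp only [hfIdx]; omega) (by simp only [hfIdx]; omega)
      · exact cp_le hA k hk _ _ (by simp only [hfIdx]; omega) le_rfl
      · exact cp_le hA k hk _ _ le_rfl (by simp only [hfIdx]; omega)

/-- Numerator of the growth factor. -/
noncomputable def gnum {𝕜 : Type*} [RCLike 𝕜] {n : ℕ} (A : Matrix (Fin n) (Fin n) 𝕜) : ℝ :=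
  ⨆ k : Fin n, ⨆ i : Fin n, ⨆ j : Fin n,
      if k.1 ≤ i.1 ∧ k.1 ≤ j.1 then ‖geIter A k.1 i j‖ else 0

theorem le_gnum {𝕜 : Type*} [RCLike 𝕜] {n : ℕ} (A : Matrix (Fin n) (Fin n) 𝕜) (k i j : Fin n)
    (hi : k.1 ≤ i.1) (hj : k.1 ≤ j.1) : ‖geIter A k.1 i j‖ ≤ gnum A := by
  unfold gnum
  refine le_trans ?_ (le_ciSup (Set.finite_range _).bddAbove k)
  refine le_trans ?_ (le_ciSup (Set.finite_range _).bddAbove i)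
  refine le_trans ?_ (le_ciSup (Set.finite_range _).bddAbove j)
  rw [if_pos ⟨hi, hj⟩]

theorem gnum_le {𝕜 : Type*} [RCLike 𝕜] {n : ℕ} (A : Matrix (Fin n) (Fin n) 𝕜) (C : ℝ) (hC : 0 ≤ C)
    (h : ∀ k i j : Fin n, k.1 ≤ i.1 → k.1 ≤ j.1 → ‖geIter A k.1 i j‖ ≤ C) : gnum A ≤ C := by
  unfold gnum
  refine Real.iSup_le (fun k => Real.iSup_le (fun i => Real.iSup_le (fun j => ?_) hC) hC) hC
  split_ifs with hh
  · exact h k i j hh.1 hh.2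
  · exact hC

theorem gnum_nonneg {𝕜 : Type*} [RCLike 𝕜] {n : ℕ} (A : Matrix (Fin n) (Fin n) 𝕜) :
    0 ≤ gnum A := by
  unfold gnum
  refine Real.iSup_nonneg fun k => Real.iSup_nonneg fun i => Real.iSup_nonneg fun j => ?_
  split_ifs
  · exact norm_nonneg _
  · exact le_rfl

theorem growth_nonneg {𝕜 : Type*} [RCLike 𝕜] {n : ℕ} (A : Matrix (Fin n) (Fin n) 𝕜) :
    0 ≤ growth A :=
  div_nonneg (gnum_nonneg A) (Real.iSup_nonneg fun i => Real.iSup_nonneg fun j => norm_nonneg _)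

theorem growth_eq {𝕜 : Type*} [RCLike 𝕜] {n : ℕ} {A : Matrix (Fin n) (Fin n) 𝕜} (hA : IsCP A)
    (hn : 0 < n) : growth A = gnum A / ‖A ⟨0, hn⟩ ⟨0, hn⟩‖ := by
  have : (⨆ i : Fin n, ⨆ j : Fin n, ‖A i j‖) = ‖A ⟨0, hn⟩ ⟨0, hn⟩‖ := by
    apply le_antisymm
    · exact Real.iSup_le (fun i => Real.iSup_le (fun j =>
        cp_le hA 0 hn i j (Nat.zero_le _) (Nat.zero_le _)) (norm_nonneg _)) (norm_nonneg _)
    · refine le_trans ?_ (le_ciSup (Set.finite_range _).bddAbove ⟨0, hn⟩)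
      exact le_ciSup (f := fun j => ‖A ⟨0, hn⟩ j‖) (Set.finite_range _).bddAbove ⟨0, hn⟩
  unfold growth
  rw [this]
  rfl

theorem pivot_bound {𝕜 : Type*} [RCLike 𝕜] {n : ℕ} {A : Matrix (Fin n) (Fin n) 𝕜} (hA : IsCP A)
    (hn : 0 < n) (k : ℕ) (hk : k < n) :
    ‖geIter A k ⟨k, hk⟩ ⟨k, hk⟩‖ ≤ 2 ^ k * ‖A ⟨0, hn⟩ ⟨0, hn⟩‖ := by
  induction k with
  | zero => simp [geIter]
  | succ k ih =>
    have hk' : k < n := by omega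
    rw [geIter_succ_of A k hk' _ _ le_rfl le_rfl]
    refine (next_le _ _ _ _ (cp_le hA k hk' _ _ (Nat.le_succ k) (Nat.le_succ k))
      (cp_le hA k hk' _ _ (Nat.le_succ k) le_rfl)
      (cp_le hA k hk' _ _ le_rfl (Nat.le_succ k))).trans ?_
    have := ih hk'
    rw [pow_succ]
    linarith

theorem growth_le {𝕜 : Type*} [RCLike 𝕜] {n : ℕ} {A : Matrix (Fin n) (Fin n) 𝕜} (hA : IsCP A)
    (hn : 0 < n) : growth A ≤ 2 ^ n := by
  rw [growth_eq hA hn]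
  refine div_le_of_le_mul₀ (norm_nonneg _) (by positivity) (gnum_le A _ (by positivity) ?_)
  intro k i j hi hj
  refine (cp_le hA k.1 k.2 i j hi hj).trans ((pivot_bound hA hn k.1 k.2).trans ?_)
  gcongr
  · norm_num
  · exact k.2.le

theorem growth_dbl {𝕜 : Type*} [RCLike 𝕜] {n : ℕ} {A : Matrix (Fin n) (Fin n) 𝕜} (hA : IsCP A)
    (hn : 0 < n) : growth A ≤ growth (dbl A) / 2 := by
  rw [growth_eq hA hn, growth_eq (isCP_dbl hA) (by omega)]
  have h0 : dbl A ⟨0, by omega⟩ ⟨0, by omega⟩ = A ⟨0, hn⟩ ⟨0, hn⟩ :=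
    dbl_pivot_even hA 0 hn (by omega)
  rw [h0, div_right_comm]
  have hC := gnum_nonneg (dbl A)
  gcongr
  refine gnum_le A _ (by positivity) fun k i j hi hj => ?_
  refine (cp_le hA k.1 k.2 i j hi hj).trans ?_
  have h2 : 2 * k.1 + 1 < 2 * n := by have := k.2; omega
  have := le_gnum (dbl A) ⟨2 * k.1 + 1, h2⟩ ⟨2 * k.1 + 1, h2⟩ ⟨2 * k.1 + 1, h2⟩ le_rfl le_rfl
  rw [dbl_pivot_odd hA k.1 k.2, norm_mul, norm_neg, RCLike.norm_ofNat] at this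
  linarith

/-- `g[CP_{2n}(𝕜)] ≥ 2·g[CP_n(𝕜)]`. -/
theorem gCP_double {𝕜 : Type*} [RCLike 𝕜] (n : ℕ) (hn : 1 ≤ n) :
    2 * gCP 𝕜 n ≤ gCP 𝕜 (2 * n) := by
  have hB : BddAbove (growth '' {A : Matrix (Fin (2 * n)) (Fin (2 * n)) 𝕜 | IsCP A}) := by
    refine ⟨2 ^ (2 * n), ?_⟩
    rintro _ ⟨A, hA, rfl⟩
    exact growth_le hA (by omega)
  have h0 : 0 ≤ gCP 𝕜 (2 * n) := by
    apply Real.sSup_nonneg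
    rintro _ ⟨A, -, rfl⟩
    exact growth_nonneg A
  have : gCP 𝕜 n ≤ gCP 𝕜 (2 * n) / 2 := by
    apply Real.sSup_le _ (by positivity)
    rintro _ ⟨A, hA, rfl⟩
    have h1 := growth_dbl hA (by omega)
    have h2 : growth (dbl A) ≤ gCP 𝕜 (2 * n) := le_csSup hB ⟨dbl A, isCP_dbl hA, rfl⟩
    linarith
  linarith
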